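/- The restriction to S_i of the composition Φ_i^ε ∘ Ψ_N^ε of the hyperedge reference map with the inverse node reference map is independent of ε and is given by the affine map (Φ_i^ε ∘ Ψ_N^ε)|_{S_i}(x) = A_i R_i x − d e₂, where A_i = diag(1, 1, d_i^{−1}); it is an isomorphism from the face S_i of N_ref onto the face S = (0,L) × {0} × (−1/2, 1/2) of E_ref. -/

import Mathlib

/-!
**Statement 9 (ε-independence of the interface coupling map).**
The restriction to `S_i` of the composition `Φ_i^ε ∘ Ψ_N^ε` of the hyperedge reference
map with the inverse node reference map is independent of `ε` and is given by the
affine map `(Φ_i^ε ∘ Ψ_N^ε)|_{S_i}(x) = A_i R_i x − d e₂`, where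
`A_i = diag(1,1,d_i⁻¹)`; it is an isomorphism from the face `S_i` of `N_ref` onto the
face `S = (0,L) × {0} × (−1/2,1/2)` of `E_ref`.

Modeling: vectors in `ℝ³` are `Fin 3 → ℝ` and the maps are written with matrices:
`Φ_N^ε(x) = A_N^ε x` with `A_N^ε = diag(1, ε⁻¹, ε⁻¹)`, so `Ψ_N^ε = (Φ_N^ε)⁻¹` is
multiplication by `diag(1, ε, ε)`; `Φ_i^ε(x) = A_i^ε R_i x + a_i^ε` with
`A_i^ε = diag(1, L/(L_i − αε), 1/(d_i ε))`, `a_i^ε = (0, −αεL/(L_i − αε), 0)ᵀ`, and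
`R_i` a rotation around the `x₁`-axis mapping the unit normal `ν_i` of the planar
hyperedge `E_i` to `e₃` (so `R_i e₁ = e₁` and the `e₁`-row and `e₁`-column of `R_i`
are trivial).  The face `S_i = Φ_N^ε(S_i^ε) ⊂ (0,L) × ∂ω` of `N_ref` consists exactly
of the (rescaled) points at in-plane distance `α` from the hypernode axis, i.e.
`R_i x = (x₁, α, t)` with `x₁ ∈ (0,L)`, `t ∈ (−d_i/2, d_i/2)`; in particular the
second component of `R_i x` equals `d` on `S_i`, where `d = α`.
-/
theorem interface_coupling_map_eps_independent
    (L Li di α d : ℝ)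
    (hL : 0 < L) (hLi : 0 < Li) (hdi : 0 < di) (hα : 0 < α)
    (hd : d = α)
    (R : Matrix (Fin 3) (Fin 3) ℝ)
    -- `R` is a rotation around the `x₁`-axis
    (hRorth : R * R.transpose = 1)
    (hR00 : R 0 0 = 1) (hR01 : R 0 1 = 0) (hR02 : R 0 2 = 0)
    (hR10 : R 1 0 = 0) (hR20 : R 2 0 = 0) :
    -- the face `S_i` of `N_ref` interfacing with the `i`-th extruded hyperedge
    let Si : Set (Fin 3 → ℝ) :=
      {x | x 0 ∈ Set.Ioo 0 L ∧ R.mulVec x 1 = α ∧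
        R.mulVec x 2 ∈ Set.Ioo (-(di / 2)) (di / 2)}
    -- the face `S = (0,L) × {0} × (−1/2,1/2)` of `E_ref`
    let S : Set (Fin 3 → ℝ) :=
      {y | y 0 ∈ Set.Ioo 0 L ∧ y 1 = 0 ∧ y 2 ∈ Set.Ioo (-(1/2) : ℝ) (1/2)}
    let Ai : Matrix (Fin 3) (Fin 3) ℝ := Matrix.diagonal ![1, 1, di⁻¹]
    -- the claimed ε-independent affine map  x ↦ A_i R_i x − d e₂
    let F : (Fin 3 → ℝ) → (Fin 3 → ℝ) :=
      fun x => Ai.mulVec (R.mulVec x) - d • (![0, 1, 0] : Fin 3 → ℝ)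
    -- the second component of `R_i x` equals `d` on `S_i`
    (∀ x ∈ Si, R.mulVec x 1 = d) ∧
    -- `(Φ_i^ε ∘ Ψ_N^ε)|_{S_i} = F` for every admissible `ε`
    (∀ ε : ℝ, 0 < ε → α * ε < Li → ∀ x ∈ Si,
      (Matrix.diagonal ![1, L / (Li - α * ε), 1 / (di * ε)]).mulVec
          (R.mulVec ((Matrix.diagonal ![1, ε, ε]).mulVec x))
        + ![0, -(α * ε * L) / (Li - α * ε), 0] = F x) ∧
    -- `F` is an isomorphism from `S_i` onto `S`
    Set.BijOn F Si S := by
  intro Si S Ai F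
  have hRleft : R.transpose * R = 1 := mul_eq_one_comm.mp hRorth
  have hrow0 : ∀ x : Fin 3 → ℝ, R.mulVec x 0 = x 0 := fun x => by
    simp [Matrix.mulVec, dotProduct, Fin.sum_univ_three, hR00, hR01, hR02]
  have hF0 : ∀ x, F x 0 = x 0 := fun x => by
    simp only [F, Ai, Pi.sub_apply, Matrix.mulVec_diagonal, Pi.smul_apply, hrow0]; simp
  have hF1 : ∀ x, F x 1 = R.mulVec x 1 - d := fun x => by
    simp only [F, Ai, Pi.sub_apply, Matrix.mulVec_diagonal, Pi.smul_apply]; simp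
  have hF2 : ∀ x, F x 2 = di⁻¹ * R.mulVec x 2 := fun x => by
    simp only [F, Ai, Pi.sub_apply, Matrix.mulVec_diagonal, Pi.smul_apply]; simp
  refine ⟨fun x hx => hx.2.1.trans hd.symm, ?_, ?_, ?_, ?_⟩
  · intro ε hε hεL x hx
    have hscale : R.mulVec ((Matrix.diagonal ![1, ε, ε]).mulVec x)
        = ![x 0, ε * R.mulVec x 1, ε * R.mulVec x 2] := by
      ext i
      fin_cases i <;>
        simp [Matrix.mulVec, dotProduct, Matrix.diagonal_apply, Fin.sum_univ_three,
          hR00, hR01, hR02, hR10, hR20] <;> ring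
    have hne : Li - α * ε ≠ 0 := by linarith
    rw [hscale]
    ext i
    fin_cases i
    · simp [hF0, Matrix.mulVec_diagonal]
    · simp only [Fin.mk_one, hF1, hx.2.1, hd]
      simp [Matrix.mulVec_diagonal]
      field_simp
      ring
    · simp only [Fin.reduceFinMk, hF2]
      simp [Matrix.mulVec_diagonal]
      field_simp
  · rintro x ⟨hx0, hx1, hx2, hx3⟩
    refine ⟨by rwa [hF0], by rw [hF1, hx1, hd, sub_self], ?_⟩
    rw [hF2, inv_mul_eq_div, Set.mem_Ioo, lt_div_iff₀ hdi, div_lt_iff₀ hdi]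
    constructor <;> linarith
  · intro x _ y _ hxy
    have hR : R.mulVec x = R.mulVec y := by
      ext i
      have h := congrFun hxy i
      fin_cases i
      · simpa [hF0, hrow0] using h
      · simpa [hF1] using h
      · simpa [hF2, hdi.ne'] using h
    simpa [Matrix.mulVec_mulVec, hRleft] using congrArg R.transpose.mulVec hR
  · rintro y ⟨hy0, hy1, hy2, hy3⟩
    obtain ⟨x, hx⟩ : ∃ x, R.mulVec x = ![y 0, α, di * y 2] :=
      ⟨R.transpose.mulVec ![y 0, α, di * y 2], by simp [Matrix.mulVec_mulVec, hRorth]⟩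
    have hx0 : x 0 = y 0 := by rw [← hrow0 x, hx]; rfl
    have hx1 : R.mulVec x 1 = α := by rw [hx]; rfl
    have hx2 : R.mulVec x 2 = di * y 2 := by rw [hx]; rfl
    refine ⟨x, ⟨by rwa [hx0], hx1, ?_, ?_⟩, ?_⟩
    · rw [hx2]; nlinarith
    · rw [hx2]; nlinarith
    · ext i
      fin_cases i
      · simp [hF0, hx0]
      · simp [hF1, hx1, hd, hy1]
      · simp [hF2, hx2, hdi.ne']
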